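/- Let f : ℝ^n → ℝ^n be a vector field symmetric with respect to a linear map P : ℝ^n → ℝ^n, and let ψ : ℝ^n → ℂ be a Koopman eigenfunction of f with eigenvalue λ ∈ ℂ. Then the composition x ↦ ψ(P x) is differentiable and is also a Koopman eigenfunction of f with the same eigenvalue λ; that is, D(ψ∘P)(x)[f(x)] = λ·ψ(P x) for all x ∈ ℝ^n. (Forward direction of the paper's Theorem 4.) -/

import Mathlib

/-- If a vector field `f` on `ℝ^n` is symmetric with respect to a linear map `P`
(`f (P x) = P (f x)`), and `ψ` is a Koopman eigenfunction of `f` with eigenvalue `lam`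
(`fderiv ℝ ψ x (f x) = lam * ψ x` for all `x`), then `x ↦ ψ (P x)` is differentiable and is
also a Koopman eigenfunction of `f` with the same eigenvalue `lam`. -/
theorem koopman_eigenfunction_comp_symmetry
    {n : ℕ} (f : (Fin n → ℝ) → (Fin n → ℝ))
    (P : (Fin n → ℝ) →ₗ[ℝ] (Fin n → ℝ))
    (hsym : ∀ x, f (P x) = P (f x))
    (ψ : (Fin n → ℝ) → ℂ) (lam : ℂ)
    (hψ : Differentiable ℝ ψ)
    (heig : ∀ x, fderiv ℝ ψ x (f x) = lam * ψ x) :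
    Differentiable ℝ (fun x => ψ (P x)) ∧
      ∀ x, fderiv ℝ (fun y => ψ (P y)) x (f x) = lam * ψ (P x) := by
  have hcomp : ∀ x, HasFDerivAt (fun y => ψ (P y))
      ((fderiv ℝ ψ (P x)).comp (LinearMap.toContinuousLinearMap P)) x := fun x =>
    HasFDerivAt.comp x (hψ (P x)).hasFDerivAt (LinearMap.toContinuousLinearMap P).hasFDerivAt
  refine ⟨fun x => (hcomp x).differentiableAt, fun x => ?_⟩
  rw [(hcomp x).fderiv, ← heig (P x), hsym x]
  rfl
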